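/- arXiv:1211.6293 — 2 statements merged into one kernel-verified Lean document; each statement's English description precedes it below -/
import Mathlib

section
/- Let p be a prime with p ≥ 5 and let 𝒪 be the conjugacy class of p-cycles in the symmetric group S_p on p letters. Then 𝒪 is of type D: there exist σ, τ ∈ 𝒪 such that (στ)² ≠ (τσ)² and σ and τ are not conjugate in ⟨σ, τ⟩. -/
/-- A subset `O` of a group (e.g. a conjugacy class) is *of type D* if it contains
elements `σ`, `τ` with `(στ)² ≠ (τσ)²` that are not conjugate in `⟨σ, τ⟩`. -/
def IsTypeD {G : Type*} [Group G] (O : Set G) : Prop :=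
  ∃ σ ∈ O, ∃ τ ∈ O,
    (σ * τ) ^ 2 ≠ (τ * σ) ^ 2 ∧
    ¬ ∃ x ∈ Subgroup.closure ({σ, τ} : Set G), x * σ * x⁻¹ = τ

theorem pCycle_class_in_Sp_typeD (p : ℕ) (hp : p.Prime) (hp5 : 5 ≤ p) :
    IsTypeD {σ : Equiv.Perm (Fin p) | σ.IsCycle ∧ σ.support.card = p} := by
  have hodd : Odd p := hp.odd_of_ne_two (by omega)
  obtain ⟨n, rfl⟩ : ∃ n, p = n + 5 := ⟨p - 5, by omega⟩
  have hcyc : (finRotate (n + 5)).IsCycle := isCycle_finRotate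
  have hsupp : (finRotate (n + 5)).support = Finset.univ := support_finRotate
  have hrot : ∀ (k : ℕ) (hk : k + 1 < n + 5) (hk' : k < n + 5),
      finRotate (n + 5) ⟨k, hk'⟩ = ⟨k + 1, hk⟩ := by
    intro k hk hk'
    exact finRotate_of_lt (n := n + 4) (by omega)
  have hsign : Equiv.Perm.sign (finRotate (n + 5)) = 1 := by
    rw [sign_finRotate]
    exact Even.neg_one_pow (by rcases hodd with ⟨k, hk⟩; exact ⟨k, by omega⟩)
  have hdiff : (finRotate (n + 5) * (Equiv.swap 0 2 * finRotate (n + 5) * Equiv.swap 0 2)) ^ 2 ≠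
      ((Equiv.swap 0 2 * finRotate (n + 5) * Equiv.swap 0 2) * finRotate (n + 5)) ^ 2 := by
    intro h
    rcases Nat.eq_zero_or_pos n with rfl | hn
    · revert h; decide
    have hn2 : 2 ≤ n := by
      rcases hodd with ⟨k, hk⟩; omega
    have h0 := congrArg (fun f => f (⟨0, by omega⟩ : Fin (n + 5))) h
    have e0 : (0 : Fin (n + 5)) = ⟨0, by omega⟩ := rfl
    have e2 : (2 : Fin (n + 5)) = ⟨2, by omega⟩ := by
      ext; simp [Nat.mod_eq_of_lt]
    have hs : ∀ (k : ℕ) (hk : k < n + 5), k ≠ 0 → k ≠ 2 →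
        Equiv.swap (⟨0, by omega⟩ : Fin (n + 5)) ⟨2, by omega⟩ ⟨k, hk⟩ = ⟨k, hk⟩ := by
      intro k hk h0 h2
      apply Equiv.swap_apply_of_ne_of_ne <;> simpa [Fin.ext_iff]
    simp only [e0, e2, pow_two, Equiv.Perm.mul_apply, Equiv.swap_apply_left] at h0
    rw [hrot 2 (by omega), hs 3 (by omega) (by omega) (by omega), hrot 3 (by omega),
      hs 4 (by omega) (by omega) (by omega), hrot 4 (by omega),
      hs 5 (by omega) (by omega) (by omega), hrot 5 (by omega), hrot 0 (by omega),
      hs 1 (by omega) (by omega) (by omega), hrot 1 (by omega), Equiv.swap_apply_right,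
      hrot 0 (by omega),
      hs 1 (by omega) (by omega) (by omega), hrot 1 (by omega), Equiv.swap_apply_right] at h0
    simp at h0
  generalize finRotate (n + 5) = σ at *
  have hne : (0 : Fin (n + 5)) ≠ 2 := by
    intro h
    have := congrArg Fin.val h
    simp [Nat.mod_eq_of_lt] at this
  refine ⟨σ, ⟨hcyc, by simp [hsupp]⟩, Equiv.swap 0 2 * σ * Equiv.swap 0 2, ⟨?_, ?_⟩, hdiff, ?_⟩
  · simpa using hcyc.conj (g := Equiv.swap 0 2)
  · have := Equiv.Perm.card_support_conj (σ := Equiv.swap (0 : Fin (n + 5)) 2) (τ := σ)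
    rw [Equiv.swap_inv] at this
    rw [this, hsupp]; simp
  · rintro ⟨x, hx, hxe⟩
    have hxs : Equiv.Perm.sign x = 1 := by
      have : Subgroup.closure {σ, Equiv.swap 0 2 * σ * Equiv.swap 0 2} ≤
          (Equiv.Perm.sign (α := Fin (n + 5))).ker := by
        rw [Subgroup.closure_le]
        rintro y (rfl | rfl)
        · simpa [MonoidHom.mem_ker] using hsign
        · simp [MonoidHom.mem_ker, hsign, Equiv.Perm.sign_swap hne]
      exact this hx
    set y := Equiv.swap 0 2 * x with hy
    have hys : Equiv.Perm.sign y = -1 := by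
      rw [hy, map_mul, hxs, Equiv.Perm.sign_swap hne]; simp
    have hcomm : Commute y σ := by
      have h1 : x * σ = Equiv.swap 0 2 * σ * Equiv.swap 0 2 * x := by rw [← hxe]; group
      show Equiv.swap 0 2 * x * σ = σ * (Equiv.swap 0 2 * x)
      rw [mul_assoc, h1]
      simp only [← mul_assoc, Equiv.swap_mul_self, one_mul]
    have hall : ∀ z, σ z ≠ z := fun z => by
      rw [← Equiv.Perm.mem_support, hsupp]; exact Finset.mem_univ _
    obtain ⟨k, hk⟩ := hcyc.exists_zpow_eq (hall 0) (hall (y 0))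
    have hyk : y = σ ^ k := by
      ext1 z
      obtain ⟨m, rfl⟩ := hcyc.exists_zpow_eq (hall 0) (hall z)
      have := congrArg (fun f => f 0) (hcomm.zpow_right m).eq
      simp only [Equiv.Perm.mul_apply] at this
      rw [this, ← hk, ← Equiv.Perm.mul_apply, ← Equiv.Perm.mul_apply, ← zpow_add, ← zpow_add,
        add_comm m k]
    rw [hyk, map_zpow, hsign, one_zpow] at hys
    exact absurd hys (by decide)
end

section
/- Let F be a finite field with r elements, let k ≥ 2 be a natural number, and suppose p := (r^k − 1)/(r − 1) is a prime number with p ≥ 13. If C₁ and C₂ are conjugacy classes of SL_k(F) all of whose elements have order p, then there exist σ ∈ C₁ and τ ∈ C₂ such that the order of στ is different from 1, 2 and p. -/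
open Polynomial Matrix

lemma irr_charpoly_of_order {F : Type*} [Field F] [Fintype F]
    (r k p : ℕ) (hr : Fintype.card F = r) (hk : 2 ≤ k)
    (hp : p = (r ^ k - 1) / (r - 1)) (hpp : p.Prime)
    (a : Matrix.SpecialLinearGroup (Fin k) F) (ha : orderOf a = p) :
    Irreducible (a : Matrix (Fin k) (Fin k) F).charpoly := by
  set A : Matrix (Fin k) (Fin k) F := (a : Matrix (Fin k) (Fin k) F) with hA
  have hr2 : 2 ≤ r := by rw [← hr]; exact Fintype.one_lt_card
  have hgeom : p = ∑ i ∈ Finset.range k, r ^ i := by rw [hp, Nat.geomSum_eq hr2]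
  obtain ⟨l, rfl⟩ : ∃ l, k = l + 1 := ⟨k - 1, by omega⟩
  have hlt : r ^ l < p := by
    rw [hgeom, Finset.sum_range_succ]
    have : 0 < ∑ i ∈ Finset.range l, r ^ i :=
      Finset.sum_pos (fun i _ => by positivity) ⟨0, by simp; omega⟩
    omega
  have hrp : r.Coprime p := by
    refine ((Nat.Prime.coprime_iff_not_dvd hpp).2 ?_).symm
    intro h
    have h1 := Nat.le_of_dvd (by omega) h
    have h2 : r ^ 1 ≤ r ^ l := Nat.pow_le_pow_right (by omega) (by omega)
    rw [pow_one] at h2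
    omega
  obtain ⟨c, n, hc, hcn⟩ : ∃ c n : ℕ, c.Prime ∧ Fintype.card F = c ^ n := by
    obtain ⟨n, hc, h⟩ := FiniteField.card F (ringChar F)
    exact ⟨ringChar F, n, hc, h⟩
  have : Fact c.Prime := ⟨hc⟩
  have hn0 : n ≠ 0 := by
    rintro rfl
    simp at hcn
    omega
  have hcp : c.Coprime p := by
    rw [← hr, hcn] at hrp
    exact (Nat.coprime_pow_left_iff (Nat.pos_of_ne_zero hn0) _ _).1 hrp
  -- a ≠ 1, a ^ p = 1
  have hAp : A ^ p = 1 := by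
    have := pow_orderOf_eq_one a
    rw [ha] at this
    rw [hA, ← Matrix.SpecialLinearGroup.coe_pow, this, Matrix.SpecialLinearGroup.coe_one]
  have hA1 : A ≠ 1 := by
    intro h
    have : a = 1 := Subtype.ext h
    rw [this, orderOf_one] at ha
    exact hpp.one_lt.ne ha
  have hnc : ¬ IsCoprime (cyclotomic p F) A.charpoly := by
    rintro ⟨u, w, huw⟩
    have h1 := congrArg (aeval A) huw
    simp only [map_add, map_mul, map_one, Matrix.aeval_self_charpoly, mul_zero, add_zero] at h1
    have : Fact p.Prime := ⟨hpp⟩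
    have h2 := congrArg (aeval A) (cyclotomic_prime_mul_X_sub_one F p)
    simp only [map_mul, map_sub, map_pow, aeval_X, map_one, hAp, sub_self] at h2
    apply hA1
    have h3 := congrArg (fun M => aeval A u * M) h2
    simp only [← mul_assoc, h1, one_mul, mul_zero] at h3
    exact sub_eq_zero.1 h3
  have hdeg : A.charpoly.natDegree = l + 1 := by
    rw [Matrix.charpoly_natDegree_eq_dim]; simp
  obtain ⟨q, hq, hq1, hq2⟩ : ∃ q, Irreducible q ∧ q ∣ cyclotomic p F ∧ q ∣ A.charpoly := by
    by_contra! h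
    apply hnc
    refine isCoprime_of_irreducible_dvd ?_ (fun z hz h1 h2 => h z hz h1 h2)
    rintro ⟨-, h⟩
    exact (Matrix.charpoly_monic A).ne_zero h
  have hqd := natDegree_of_dvd_cyclotomic_of_irreducible hcn hcp hq1 hq
  have hle : l + 1 ≤ q.natDegree := by
    by_contra! hlt'
    have hpos := hq.natDegree_pos
    have h1 := pow_orderOf_eq_one (ZMod.unitOfCoprime _ (hcp.pow_left n))
    rw [← hqd] at h1
    have h2 := congrArg Units.val h1
    simp only [Units.val_pow_eq_pow_val, ZMod.coe_unitOfCoprime, Units.val_one] at h2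
    rw [← hcn, hr] at h2
    have h3 : ((r ^ q.natDegree : ℕ) : ZMod p) = ((1 : ℕ) : ZMod p) := by
      push_cast; exact h2
    rw [ZMod.natCast_eq_natCast_iff] at h3
    have h4 := (Nat.modEq_iff_dvd' (Nat.one_le_pow _ _ (by omega))).1 h3.symm
    have h5 : 1 < r ^ q.natDegree := Nat.one_lt_pow hpos.ne' hr2
    have h6 := Nat.le_of_dvd (by omega) h4
    have h7 : r ^ q.natDegree ≤ r ^ l := Nat.pow_le_pow_right (by omega) (by omega)
    omega
  exact (associated_of_dvd_of_natDegree_le hq2 (Matrix.charpoly_monic A).ne_zero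
    (by rw [hdeg]; exact hle)).irreducible hq

lemma exists_equiv_adjoinRoot {F : Type*} [Field F] {k : ℕ} (hk : 0 < k)
    (A : Matrix (Fin k) (Fin k) F) (hA : Irreducible A.charpoly) :
    ∃ (L : AdjoinRoot A.charpoly →ₐ[F] Matrix (Fin k) (Fin k) F)
      (e : AdjoinRoot A.charpoly ≃ₗ[F] (Fin k → F)),
      L (AdjoinRoot.root _) = A ∧ ∀ x y, e (x * y) = L x *ᵥ e y := by
  have : Fact (Irreducible A.charpoly) := ⟨hA⟩
  let L : AdjoinRoot A.charpoly →ₐ[F] Matrix (Fin k) (Fin k) F :=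
    Ideal.Quotient.liftₐ _ (aeval A) (fun q hq => by
      obtain ⟨w, rfl⟩ := Ideal.mem_span_singleton.1 hq
      rw [map_mul, Matrix.aeval_self_charpoly, zero_mul])
  have hL : L (AdjoinRoot.root _) = A := by
    change aeval A (X : F[X]) = A
    simp
  let v : Fin k → F := Pi.single ⟨0, hk⟩ 1
  have hv : v ≠ 0 := by
    intro h
    have := congrFun h ⟨0, hk⟩
    simp [v] at this
  let f : AdjoinRoot A.charpoly →ₗ[F] (Fin k → F) :=
    { toFun := fun x => L x *ᵥ v
      map_add' := fun x y => by rw [map_add, Matrix.add_mulVec]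
      map_smul' := fun c x => by rw [map_smul, Matrix.smul_mulVec]; rfl }
  have hf : Function.Injective f := by
    rw [injective_iff_map_eq_zero]
    intro x hx
    by_contra hx0
    apply hv
    have h1 : L x⁻¹ *ᵥ (L x *ᵥ v) = 0 := by
      have : L x *ᵥ v = 0 := hx
      rw [this, Matrix.mulVec_zero]
    rwa [Matrix.mulVec_mulVec, ← map_mul, inv_mul_cancel₀ hx0, map_one, Matrix.one_mulVec] at h1
  have : FiniteDimensional F (AdjoinRoot A.charpoly) := (AdjoinRoot.powerBasis hA.ne_zero).finite
  have hd : Module.finrank F (AdjoinRoot A.charpoly) = Module.finrank F (Fin k → F) := by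
    rw [(AdjoinRoot.powerBasis hA.ne_zero).finrank, AdjoinRoot.powerBasis_dim,
      Matrix.charpoly_natDegree_eq_dim]
    simp
  refine ⟨L, LinearEquiv.ofInjectiveOfFinrankEq f hf hd, hL, fun x y => ?_⟩
  change L (x * y) *ᵥ v = L x *ᵥ (L y *ᵥ v)
  rw [map_mul, Matrix.mulVec_mulVec]

lemma exists_conj_chain {F : Type*} [Field F] [Finite F] {k : ℕ} (hk : 0 < k)
    (a : Matrix.SpecialLinearGroup (Fin k) F)
    (hA : Irreducible (a : Matrix (Fin k) (Fin k) F).charpoly)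
    {m : ℕ} (hm : m ≤ k) (x : Fin m → (Fin k → F)) (hx : LinearIndependent F x) :
    ∃ σ : Matrix.SpecialLinearGroup (Fin k) F, IsConj a σ ∧
      ∀ i j : Fin m, (i : ℕ) + 1 = j →
        (σ : Matrix (Fin k) (Fin k) F) *ᵥ x i = x j := by
  set A : Matrix (Fin k) (Fin k) F := (a : Matrix (Fin k) (Fin k) F) with hAdef
  obtain ⟨L, e, hL, he⟩ := exists_equiv_adjoinRoot hk _ hA
  have : Fact (Irreducible A.charpoly) := ⟨hA⟩
  have : FiniteDimensional F (AdjoinRoot A.charpoly) := (AdjoinRoot.powerBasis hA.ne_zero).finite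
  have : Finite (AdjoinRoot A.charpoly) := Module.finite_of_finite F
  have hdeg : A.charpoly.natDegree = k := by
    rw [Matrix.charpoly_natDegree_eq_dim]; simp
  -- determinant of `L x`
  have hdet : ∀ z, (L z).det = Algebra.norm F z := by
    intro z
    rw [Algebra.norm_apply, ← LinearMap.det_conj _ e, ← LinearMap.det_toLin']
    congr 1
    refine LinearMap.ext fun w => ?_
    simp [he]
  let y : Fin m → (Fin k → F) := fun i => e (AdjoinRoot.root A.charpoly ^ (i : ℕ))
  have hy : LinearIndependent F y := by
    have h1 := (AdjoinRoot.powerBasis hA.ne_zero).basis.linearIndependent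
    rw [PowerBasis.coe_basis] at h1
    have hm' : m ≤ (AdjoinRoot.powerBasis hA.ne_zero).dim := by
      rw [AdjoinRoot.powerBasis_dim, hdeg]; exact hm
    have h2 := h1.comp (Fin.castLE hm') (Fin.castLE_injective hm')
    have h3 := h2.map' (e : AdjoinRoot A.charpoly →ₗ[F] (Fin k → F)) e.ker
    exact h3
  have hAy : ∀ i j : Fin m, (i : ℕ) + 1 = j → A *ᵥ y i = y j := by
    intro i j hij
    simp only [y]
    rw [← hij, pow_succ', he, hL]
  obtain ⟨g, hg⟩ := Submodule.exists_linearEquiv_restrict_eq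
    (hy.linearCombinationEquiv.symm ≪≫ₗ hx.linearCombinationEquiv)
  have hgy : ∀ i, g (y i) = x i := by
    intro i
    have h := hg (hy.linearCombinationEquiv (Finsupp.single i 1))
    simp at h
    exact h.symm
  let G : Matrix (Fin k) (Fin k) F := LinearMap.toMatrix' (g : (Fin k → F) →ₗ[F] (Fin k → F))
  have hG : ∀ w, G *ᵥ w = g w := fun w => by simp [G, LinearMap.toMatrix'_mulVec]
  have hGdet : G.det ≠ 0 := by
    simp only [G, LinearMap.det_toMatrix']
    exact (LinearEquiv.isUnit_det' g).ne_zero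
  obtain ⟨z, hz⟩ := FiniteField.norm_surjective F (AdjoinRoot A.charpoly) G.det⁻¹
  have hz0 : z ≠ 0 := by
    rintro rfl
    rw [Algebra.norm_zero] at hz
    exact inv_ne_zero hGdet hz.symm
  have hGL : (G * L z).det = 1 := by
    rw [Matrix.det_mul, hdet, hz, mul_inv_cancel₀ hGdet]
  let s : Matrix.SpecialLinearGroup (Fin k) F := ⟨G * L z, hGL⟩
  refine ⟨s * a * s⁻¹, isConj_iff.2 ⟨s, rfl⟩, fun i j hij => ?_⟩
  have hcomm : A * L z = L z * A := by
    have h1 : L (AdjoinRoot.root _ * z) = L (z * AdjoinRoot.root _) := by rw [mul_comm]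
    rwa [map_mul, map_mul, hL] at h1
  have hzz : L z * L z⁻¹ = 1 := by rw [← map_mul, mul_inv_cancel₀ hz0, map_one]
  have hs : (s : Matrix (Fin k) (Fin k) F) *ᵥ (L z⁻¹ *ᵥ y i) = x i := by
    change (G * L z) *ᵥ _ = _
    rw [Matrix.mulVec_mulVec, Matrix.mul_assoc, hzz, Matrix.mul_one, hG, hgy]
  have hss : ((s⁻¹ : Matrix.SpecialLinearGroup (Fin k) F) : Matrix (Fin k) (Fin k) F) *
      (s : Matrix (Fin k) (Fin k) F) = 1 := by
    rw [← Matrix.SpecialLinearGroup.coe_mul, inv_mul_cancel, Matrix.SpecialLinearGroup.coe_one]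
  rw [← hs, Matrix.SpecialLinearGroup.coe_mul, Matrix.mulVec_mulVec, Matrix.mul_assoc, hss,
    Matrix.mul_one, Matrix.SpecialLinearGroup.coe_mul, ← Matrix.mulVec_mulVec]
  change (G * L z) *ᵥ (A *ᵥ (L z⁻¹ *ᵥ y i)) = _
  have hfin : G * L z * (A * L z⁻¹) = G * A := by
    rw [Matrix.mul_assoc, ← Matrix.mul_assoc (L z), ← hcomm, Matrix.mul_assoc A, hzz,
      Matrix.mul_one]
  rw [Matrix.mulVec_mulVec, Matrix.mulVec_mulVec, Matrix.mul_assoc, hfin, ← Matrix.mulVec_mulVec, hAy i j hij, hG, hgy]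

lemma orders_ne {F : Type*} [Field F] [Fintype F]
    (r k p : ℕ) (hr : Fintype.card F = r) (hk : 2 ≤ k)
    (hp : p = (r ^ k - 1) / (r - 1)) (hpp : p.Prime)
    (M : Matrix.SpecialLinearGroup (Fin k) F) (v w : Fin k → F) (hv : v ≠ 0) (c : F)
    (hMv : (M : Matrix (Fin k) (Fin k) F) *ᵥ v = c • v)
    (hMw : (M : Matrix (Fin k) (Fin k) F) *ᵥ ((M : Matrix (Fin k) (Fin k) F) *ᵥ w) ≠ w) :
    orderOf M ≠ 1 ∧ orderOf M ≠ 2 ∧ orderOf M ≠ p := by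
  have hM2 : M ^ 2 ≠ 1 := by
    intro h
    apply hMw
    have h1 := congrArg (fun N : Matrix.SpecialLinearGroup (Fin k) F =>
      (N : Matrix (Fin k) (Fin k) F)) h
    simp only [Matrix.SpecialLinearGroup.coe_pow, Matrix.SpecialLinearGroup.coe_one] at h1
    rw [Matrix.mulVec_mulVec, ← sq, h1, Matrix.one_mulVec]
  refine ⟨fun h => ?_, fun h => ?_, fun h => ?_⟩
  · rw [orderOf_eq_one_iff] at h
    exact hM2 (by rw [h, one_pow])
  · exact hM2 (by rw [← h, pow_orderOf_eq_one])
  · have hirr := irr_charpoly_of_order r k p hr hk hp hpp M h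
    have hroot : (M : Matrix (Fin k) (Fin k) F).charpoly.IsRoot c := by
      rw [IsRoot.def, Matrix.eval_charpoly, ← Matrix.exists_mulVec_eq_zero_iff]
      refine ⟨v, hv, ?_⟩
      rw [Matrix.sub_mulVec, hMv]
      simp
    have h1 := natDegree_eq_of_degree_eq_some (degree_eq_one_of_irreducible_of_root hirr hroot)
    rw [Matrix.charpoly_natDegree_eq_dim] at h1
    rw [Fintype.card_fin] at h1
    have h1' : k = 1 := h1
    omega

lemma linInd_single {F : Type*} [Field F] {k m : ℕ} (hm : m ≤ k) :
    LinearIndependent F (fun i : Fin m => (Pi.single (Fin.castLE hm i) 1 : Fin k → F)) := by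
  have h := (Pi.basisFun F (Fin k)).linearIndependent.comp _ (Fin.castLE_injective hm)
  convert h using 1
  funext i
  simp

theorem exists_product_of_order_ne_one_two_p_in_SL (F : Type*) [Field F] [Fintype F]
    (r k p : ℕ) (hr : Fintype.card F = r) (hk : 2 ≤ k)
    (hp : p = (r ^ k - 1) / (r - 1)) (hpp : p.Prime) (hp13 : 13 ≤ p)
    (C₁ C₂ : Set (Matrix.SpecialLinearGroup (Fin k) F))
    (a b : Matrix.SpecialLinearGroup (Fin k) F)
    (ha : orderOf a = p) (hb : orderOf b = p)
    (hC₁ : C₁ = {x | IsConj a x}) (hC₂ : C₂ = {x | IsConj b x}) :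
    ∃ σ ∈ C₁, ∃ τ ∈ C₂,
      orderOf (σ * τ) ≠ 1 ∧ orderOf (σ * τ) ≠ 2 ∧ orderOf (σ * τ) ≠ p := by
  have hia := irr_charpoly_of_order r k p hr hk hp hpp a ha
  have hib := irr_charpoly_of_order r k p hr hk hp hpp b hb
  have hr2 : 2 ≤ r := by rw [← hr]; exact Fintype.one_lt_card
  have hk0 : 0 < k := by omega
  subst hC₁ hC₂
  by_cases hr4 : 4 ≤ r
  · -- an eigenvalue `c` with `c ^ 2 ≠ 1`
    classical
    obtain ⟨c, hc⟩ : ∃ c : F, c ∉ ({0, 1, -1} : Finset F) := by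
      by_contra! h
      have h1 : Fintype.card F ≤ ({0, 1, -1} : Finset F).card :=
        Finset.card_le_card (fun x _ => h x)
      have h2 := Finset.card_le_three (a := (0 : F)) (b := 1) (c := -1)
      omega
    simp only [Finset.mem_insert, Finset.mem_singleton, not_or] at hc
    obtain ⟨hc0, hc1, hc2⟩ := hc
    have hE := linInd_single (F := F) hk
    set E : Fin 2 → (Fin k → F) := fun i => Pi.single (Fin.castLE hk i) 1
    obtain ⟨τ, hτ, hτE⟩ := exists_conj_chain hk0 b hib hk E hE
    have hx : LinearIndependent F ![E 1, c • E 0] := by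
      rw [Fintype.linearIndependent_iff] at hE ⊢
      intro g hg
      have h := hE ![g 1 * c, g 0] (by
        rw [← hg]
        simp [Fin.sum_univ_succ, smul_smul, add_comm])
      have h0 := h 0
      have h1 := h 1
      simp at h0 h1
      intro i
      fin_cases i
      · exact h1
      · exact h0.resolve_right hc0
    obtain ⟨σ, hσ, hσE⟩ := exists_conj_chain hk0 a hia hk _ hx
    refine ⟨σ, hσ, τ, hτ, ?_⟩
    have t0 := hτE 0 1 rfl
    have s0 := hσE 0 1 rfl
    simp at s0
    have hM : ((σ * τ : Matrix.SpecialLinearGroup (Fin k) F) : Matrix (Fin k) (Fin k) F) *ᵥ E 0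
        = c • E 0 := by
      rw [Matrix.SpecialLinearGroup.coe_mul, ← Matrix.mulVec_mulVec, t0, s0]
    refine orders_ne r k p hr hk hp hpp _ (E 0) (E 0) (hE.ne_zero 0) c hM ?_
    rw [hM, Matrix.mulVec_smul, hM, smul_smul]
    intro h
    have h1 : (c * c - 1) • E 0 = 0 := by rw [sub_smul, h, one_smul, sub_self]
    have h2 := (smul_eq_zero.1 h1).resolve_right (hE.ne_zero 0)
    have h3 : (c - 1) * (c + 1) = 0 := by rw [← h2]; ring
    rcases mul_eq_zero.1 h3 with h4 | h4
    · exact hc1 (sub_eq_zero.1 h4)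
    · exact hc2 (eq_neg_of_add_eq_zero_left h4)
  by_cases hk4 : 4 ≤ k
  · have hE := linInd_single (F := F) hk4
    set E : Fin 4 → (Fin k → F) := fun i => Pi.single (Fin.castLE hk4 i) 1
    obtain ⟨τ, hτ, hτE⟩ := exists_conj_chain hk0 b hib hk4 E hE
    have hE' := hE
    rw [Fintype.linearIndependent_iff] at hE'
    have hx : LinearIndependent F ![E 3, E 2 + E 1, E 1, E 0] := by
      rw [Fintype.linearIndependent_iff]
      intro g hg
      have h := hE' ![g 3, g 1 + g 2, g 1, g 0] (by
        rw [← hg]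
        simp [Fin.sum_univ_four]
        module)
      have h0 := h 0
      have h1 := h 1
      have h2 := h 2
      have h3 := h 3
      simp at h0 h1 h2 h3
      rw [h2, zero_add] at h1
      intro i
      fin_cases i
      · exact h3
      · exact h2
      · exact h1
      · exact h0
    obtain ⟨σ, hσ, hσE⟩ := exists_conj_chain hk0 a hia hk4 _ hx
    refine ⟨σ, hσ, τ, hτ, ?_⟩
    have t0 := hτE 0 1 rfl
    have t1 := hτE 1 2 rfl
    have t2 := hτE 2 3 rfl
    have s0 := hσE 0 1 rfl
    have s1 := hσE 1 2 rfl
    have s2 := hσE 2 3 rfl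
    simp at s0 s1 s2
    rw [Matrix.mulVec_add, s2] at s1
    have s1' := eq_sub_of_add_eq s1
    have hM0 : ((σ * τ : Matrix.SpecialLinearGroup (Fin k) F) : Matrix (Fin k) (Fin k) F) *ᵥ E 0
        = E 0 := by
      rw [Matrix.SpecialLinearGroup.coe_mul, ← Matrix.mulVec_mulVec, t0, s2]
    have hM1 : ((σ * τ : Matrix.SpecialLinearGroup (Fin k) F) : Matrix (Fin k) (Fin k) F) *ᵥ E 1
        = E 1 - E 0 := by
      rw [Matrix.SpecialLinearGroup.coe_mul, ← Matrix.mulVec_mulVec, t1, s1']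
    have hM2 : ((σ * τ : Matrix.SpecialLinearGroup (Fin k) F) : Matrix (Fin k) (Fin k) F) *ᵥ E 2
        = E 2 + E 1 := by
      rw [Matrix.SpecialLinearGroup.coe_mul, ← Matrix.mulVec_mulVec, t2, s0]
    refine orders_ne r k p hr hk hp hpp _ (E 0) (E 2) (hE.ne_zero 0) 1
      (by rw [hM0, one_smul]) ?_
    rw [hM2, Matrix.mulVec_add, hM2, hM1]
    intro h
    have h1 := hE' ![-1, 2, 0, 0] (by
      simp [Fin.sum_univ_four]
      rw [← sub_eq_zero] at h
      rw [← h]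
      module) 0
    simp at h1
  · -- `r = 3` and `k = 3`
    have hk3 : r = 3 ∧ k = 3 := by
      have h1 : r = 2 ∨ r = 3 := by omega
      have h2 : k = 2 ∨ k = 3 := by omega
      rcases h1 with h1 | h1 <;> rcases h2 with h2 | h2 <;> rw [h1, h2] at hp <;>
        norm_num at hp <;> omega
    have hF : (2 : F) ≠ 0 := by
      intro h2
      have h3 : ((Fintype.card F : ℕ) : F) = 0 := FiniteField.cast_card_eq_zero F
      rw [hr, hk3.1] at h3
      have h1 : (1 : F) = ((3 : ℕ) : F) - 2 := by push_cast; norm_num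
      rw [h3, h2, sub_zero] at h1
      exact one_ne_zero h1
    have hk3' : 3 ≤ k := by omega
    have hE := linInd_single (F := F) hk3'
    set E : Fin 3 → (Fin k → F) := fun i => Pi.single (Fin.castLE hk3' i) 1
    obtain ⟨τ, hτ, hτE⟩ := exists_conj_chain hk0 b hib hk3' E hE
    have hE' := hE
    rw [Fintype.linearIndependent_iff] at hE'
    have hx : LinearIndependent F ![E 2 - E 1, E 1, E 0] := by
      rw [Fintype.linearIndependent_iff]
      intro g hg
      have h := hE' ![g 2, g 1 - g 0, g 0] (by
        rw [← hg]
        simp [Fin.sum_univ_three]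
        module)
      have h0 := h 0
      have h1 := h 1
      have h2 := h 2
      simp at h0 h1 h2
      rw [h2, sub_zero] at h1
      intro i
      fin_cases i
      · exact h2
      · exact h1
      · exact h0
    obtain ⟨σ, hσ, hσE⟩ := exists_conj_chain hk0 a hia hk3' _ hx
    refine ⟨σ, hσ, τ, hτ, ?_⟩
    have t0 := hτE 0 1 rfl
    have t1 := hτE 1 2 rfl
    have s0 := hσE 0 1 rfl
    have s1 := hσE 1 2 rfl
    simp at s0 s1
    rw [Matrix.mulVec_sub, s1] at s0
    have s0' := eq_add_of_sub_eq s0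
    have hM0 : ((σ * τ : Matrix.SpecialLinearGroup (Fin k) F) : Matrix (Fin k) (Fin k) F) *ᵥ E 0
        = E 0 := by
      rw [Matrix.SpecialLinearGroup.coe_mul, ← Matrix.mulVec_mulVec, t0, s1]
    have hM1 : ((σ * τ : Matrix.SpecialLinearGroup (Fin k) F) : Matrix (Fin k) (Fin k) F) *ᵥ E 1
        = E 1 + E 0 := by
      rw [Matrix.SpecialLinearGroup.coe_mul, ← Matrix.mulVec_mulVec, t1, s0']
    refine orders_ne r k p hr hk hp hpp _ (E 0) (E 1) (hE.ne_zero 0) 1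
      (by rw [hM0, one_smul]) ?_
    rw [hM1, Matrix.mulVec_add, hM1, hM0]
    intro h
    have h1 := hE' ![2, 0, 0] (by
      rw [Fin.sum_univ_three]
      change (2 : F) • E 0 + (0 : F) • E 1 + (0 : F) • E 2 = 0
      rw [← sub_eq_zero] at h
      rw [← h]
      module) 0
    simp at h1
    exact hF h1
end
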